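/- arXiv:1705.09946 — 4 statements merged into one kernel-verified Lean document; each statement's English description precedes it below -/
import Mathlib

section
/- Let d ≥ 3 distinct lines in the real projective plane ℙ²(ℝ) be given which are not all concurrent (i.e., t_d = 0). Then t_2 ≥ 3 + Σ_{k>2} t_k(k−3). -/
open scoped BigOperators

section Pseudo
open Filter Topology

/-- number of curves strictly below height `y` at time `t` -/
noncomputable def mlo {d : ℕ} (f : Fin d → ℝ → ℝ) (t y : ℝ) : ℕ :=
  (Finset.univ.filter (fun i => f i t < y)).card
/-- number of curves weakly below height `y` at time `t` -/
noncomputable def mle {d : ℕ} (f : Fin d → ℝ → ℝ) (t y : ℝ) : ℕ :=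
  (Finset.univ.filter (fun i => f i t ≤ y)).card
/-- number of curves through `(t, y)` -/
noncomputable def mmu {d : ℕ} (f : Fin d → ℝ → ℝ) (t y : ℝ) : ℕ :=
  (Finset.univ.filter (fun i => f i t = y)).card

lemma mle_eq {d : ℕ} (f : Fin d → ℝ → ℝ) (t y : ℝ) : mle f t y = mlo f t y + mmu f t y := by
  unfold mle mlo mmu
  rw [← Finset.card_union_of_disjoint]
  · congr 1
    ext i
    simp [le_iff_lt_or_eq]
  · rw [Finset.disjoint_left]
    intro i hi hj
    simp at hi hj
    linarith

lemma mle_le {d : ℕ} (f : Fin d → ℝ → ℝ) (t y : ℝ) : mle f t y ≤ d := by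
  unfold mle
  exact (Finset.card_le_univ _).trans (by simp)

lemma mle_le_mlo {d : ℕ} (f : Fin d → ℝ → ℝ) (t : ℝ) {y y' : ℝ} (h : y < y') :
    mle f t y ≤ mlo f t y' := by
  unfold mle mlo
  apply Finset.card_le_card
  intro i hi
  simp at hi ⊢
  linarith

/-- the gap `g` is crossed at time `t` -/
def KE {d : ℕ} (f : Fin d → ℝ → ℝ) (g : ℕ) (t : ℝ) : Prop :=
  ∃ y, 2 ≤ mmu f t y ∧ mlo f t y < g ∧ g < mle f t y
/-- the gap `g` has a side corner at time `t` -/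
def SE {d : ℕ} (f : Fin d → ℝ → ℝ) (g : ℕ) (t : ℝ) : Prop :=
  ∃ y, 2 ≤ mmu f t y ∧ (mlo f t y = g ∨ mle f t y = g)
/-- position `p` is involved in a crossing at time `t` -/
def PE {d : ℕ} (f : Fin d → ℝ → ℝ) (p : ℕ) (t : ℝ) : Prop :=
  ∃ y, 2 ≤ mmu f t y ∧ mlo f t y ≤ p ∧ p < mle f t y

lemma exists_pos {d : ℕ} (f : Fin d → ℝ → ℝ) (t : ℝ) (p : ℕ) (hp : p < d) :
    ∃ x, mlo f t (f x t) ≤ p ∧ p < mle f t (f x t) := by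
  have : Nonempty (Fin d) := ⟨⟨p, hp⟩⟩
  obtain ⟨M, -, hM⟩ := Finset.exists_max_image Finset.univ (fun i => f i t) Finset.univ_nonempty
  have hMle : mle f t (f M t) = d := by
    unfold mle
    rw [Finset.filter_true_of_mem (fun i hi => hM i hi)]
    simp
  obtain ⟨x, hx, hmin⟩ := Finset.exists_min_image
    (Finset.univ.filter (fun i => p < mle f t (f i t))) (fun i => f i t) ⟨M, by simp [hMle, hp]⟩
  simp at hx hmin
  refine ⟨x, ?_, hx⟩
  by_contra! hlo
  obtain ⟨z, hz, hmax⟩ := Finset.exists_max_image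
    (Finset.univ.filter (fun i => f i t < f x t)) (fun i => f i t)
    (Finset.card_pos.mp (lt_of_le_of_lt (Nat.zero_le _) hlo))
  simp at hz hmax
  have : mlo f t (f x t) ≤ mle f t (f z t) := by
    unfold mle mlo
    apply Finset.card_le_card
    intro i hi
    simp at hi ⊢
    exact hmax i hi
  have := hmin z (by omega)
  linarith

lemma mmu_one_iff {d : ℕ} (f : Fin d → ℝ → ℝ) (t : ℝ) (x : Fin d)
    (h : ¬ 2 ≤ mmu f t (f x t)) : ∀ z, z ≠ x → f z t ≠ f x t := by
  intro z hz he
  apply h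
  unfold mmu
  have : ({z, x} : Finset (Fin d)) ⊆ Finset.univ.filter (fun i => f i t = f x t) := by
    intro i hi
    simp at hi ⊢
    rcases hi with rfl | rfl <;> simp [he]
  have h2 := Finset.card_le_card this
  rwa [Finset.card_pair hz] at h2

lemma mmu_pos {d : ℕ} (f : Fin d → ℝ → ℝ) (t : ℝ) (x : Fin d) : 1 ≤ mmu f t (f x t) := by
  unfold mmu
  exact Finset.card_pos.mpr ⟨x, by simp⟩

lemma track {d : ℕ} (f : Fin d → ℝ → ℝ) (hc : ∀ i, Continuous (f i)) (p : ℕ) (hp : p < d)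
    (a b : ℝ) (hab : a < b) (hno : ∀ t ∈ Set.Ioo a b, ¬ PE f p t) :
    ∃ x, ∀ t ∈ Set.Ioo a b, mlo f t (f x t) = p ∧ mle f t (f x t) = p + 1 ∧
      ∀ z, z ≠ x → f z t ≠ f x t := by
  choose X hX1 hX2 using fun t => exists_pos f t p hp
  have key : ∀ t ∈ Set.Ioo a b, mlo f t (f (X t) t) = p ∧ mle f t (f (X t) t) = p + 1 ∧
      ∀ z, z ≠ X t → f z t ≠ f (X t) t := by
    intro t ht
    have h2 : ¬ 2 ≤ mmu f t (f (X t) t) := fun h => hno t ht ⟨_, h, hX1 t, hX2 t⟩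
    have h1 := mmu_pos f t (X t)
    have h3 := mle_eq f t (f (X t) t)
    have h4 := hX1 t
    have h5 := hX2 t
    exact ⟨by omega, by omega, mmu_one_iff f t _ h2⟩
  have hcont : ContinuousOn X (Set.Ioo a b) := by
    intro t ht
    apply ContinuousAt.continuousWithinAt
    unfold ContinuousAt
    rw [nhds_discrete (Fin d), tendsto_pure]
    have e1 : ∀ᶠ s in 𝓝 t, ∀ i, (f i t < f (X t) t → f i s < f (X t) s) := by
      rw [eventually_all]
      intro i
      by_cases h : f i t < f (X t) t
      · filter_upwards [(hc i).continuousAt.eventually_lt (hc (X t)).continuousAt h] with s hs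
        exact fun _ => hs
      · exact Eventually.of_forall fun s h' => absurd h' h
    have e2 : ∀ᶠ s in 𝓝 t, ∀ i, (f (X t) t < f i t → f (X t) s < f i s) := by
      rw [eventually_all]
      intro i
      by_cases h : f (X t) t < f i t
      · filter_upwards [(hc (X t)).continuousAt.eventually_lt (hc i).continuousAt h] with s hs
        exact fun _ => hs
      · exact Eventually.of_forall fun s h' => absurd h' h
    filter_upwards [e1, e2, isOpen_Ioo.mem_nhds ht] with s h1 h2 hs
    obtain ⟨k1, k2, k3⟩ := key t ht
    obtain ⟨l1, l2, l3⟩ := key s hs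
    have hlo : mlo f s (f (X t) s) = p := by
      rw [← k1]
      unfold mlo
      congr 1
      ext i
      simp only [Finset.mem_filter, Finset.mem_univ, true_and]
      constructor
      · intro hi
        by_contra hcon
        rcases lt_or_eq_of_le (not_lt.mp hcon) with h | h
        · linarith [h2 i h]
        · by_cases hix : i = X t
          · rw [hix] at hi; linarith
          · exact k3 i hix h.symm
      · exact h1 i
    have hle := mle_eq f s (f (X t) s)
    have hmu := mmu_pos f s (X t)
    rcases lt_trichotomy (f (X s) s) (f (X t) s) with h | h | h
    · have := mle_le_mlo f s h
      omega
    · by_contra hne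
      exact l3 (X t) (Ne.symm hne) h.symm
    · have := mle_le_mlo f s h
      omega
  refine ⟨X ((a+b)/2), fun t ht => ?_⟩
  have := isPreconnected_Ioo.constant hcont ht (show (a+b)/2 ∈ Set.Ioo a b from
    ⟨by linarith, by linarith⟩)
  rw [← this]
  exact key t ht

lemma track_end {d : ℕ} (f : Fin d → ℝ → ℝ) (hc : ∀ i, Continuous (f i)) (p : ℕ)
    (a b : ℝ) (hab : a < b) (x : Fin d)
    (hx : ∀ t ∈ Set.Ioo a b, mlo f t (f x t) = p ∧ mle f t (f x t) = p + 1)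
    (c : ℝ) (hcab : c ∈ Set.Icc a b) (y : ℝ) (h1 : mlo f c y ≤ p) (h2 : p < mle f c y) :
    f x c = y := by
  have hne : (𝓝[Set.Ioo a b] c).NeBot := by
    rw [← mem_closure_iff_nhdsWithin_neBot, closure_Ioo hab.ne]
    exact hcab
  have hmem : ∀ᶠ t in 𝓝[Set.Ioo a b] c, t ∈ Set.Ioo a b := eventually_mem_nhdsWithin
  rcases lt_trichotomy (f x c) y with h | h | h
  · exfalso
    have e1 : ∀ᶠ s in 𝓝 c, ∀ i, (y ≤ f i c → f x s < f i s) := by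
      rw [eventually_all]
      intro i
      by_cases h' : y ≤ f i c
      · filter_upwards [(hc x).continuousAt.eventually_lt (hc i).continuousAt
          (lt_of_lt_of_le h h')] with s hs
        exact fun _ => hs
      · exact Eventually.of_forall fun s h'' => absurd h'' h'
    obtain ⟨s, hs, hs'⟩ := (hmem.and (e1.filter_mono nhdsWithin_le_nhds)).exists
    have : mle f s (f x s) ≤ mlo f c y := by
      unfold mle mlo
      apply Finset.card_le_card
      intro i hi
      simp at hi ⊢
      by_contra! hcon
      linarith [hs' i hcon]
    have := (hx s hs).2
    omega
  · exact h
  · exfalso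
    have e1 : ∀ᶠ s in 𝓝 c, ∀ i, (f i c ≤ y → f i s < f x s) := by
      rw [eventually_all]
      intro i
      by_cases h' : f i c ≤ y
      · filter_upwards [(hc i).continuousAt.eventually_lt (hc x).continuousAt
          (lt_of_le_of_lt h' h)] with s hs
        exact fun _ => hs
      · exact Eventually.of_forall fun s h'' => absurd h'' h'
    obtain ⟨s, hs, hs'⟩ := (hmem.and (e1.filter_mono nhdsWithin_le_nhds)).exists
    have : mle f c y ≤ mlo f s (f x s) := by
      unfold mle mlo
      apply Finset.card_le_card
      intro i hi
      simp at hi ⊢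
      exact hs' i hi
    have := (hx s hs).1
    omega

lemma no_isolated {d : ℕ} (f : Fin d → ℝ → ℝ) (hc : ∀ i, Continuous (f i))
    (ha : ∀ i t, f i (t + 1) = - f i t) (hn : ∀ t y, ∃ i, f i t ≠ y)
    (a b : ℝ) (hab : a + 1 ≤ b) (x : Fin d)
    (hx : ∀ t ∈ Set.Ioo a b, ∀ z, z ≠ x → f z t ≠ f x t) : False := by
  obtain ⟨z, hz⟩ := hn a (f x a)
  have hzx : z ≠ x := by rintro rfl; exact hz rfl
  have hcont : ContinuousOn (fun t => f z t - f x t) (Set.Icc a (a+1)) :=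
    ((hc z).sub (hc x)).continuousOn
  have hA := ha z a
  have hB := ha x a
  have : ∃ t ∈ Set.Ioo a (a+1), f z t - f x t = 0 := by
    rcases lt_or_gt_of_ne hz with h | h
    · exact intermediate_value_Ioo (by linarith) hcont ⟨by linarith, by linarith⟩
    · exact intermediate_value_Ioo' (by linarith) hcont ⟨by linarith, by linarith⟩
  obtain ⟨t, ht, h0⟩ := this
  exact hx t ⟨ht.1, lt_of_lt_of_le ht.2 hab⟩ z hzx (by linarith)

lemma side_between {d : ℕ} (f : Fin d → ℝ → ℝ) (hc : ∀ i, Continuous (f i))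
    (ha : ∀ i t, f i (t + 1) = - f i t) (hn : ∀ t y, ∃ i, f i t ≠ y)
    (hz : ∀ i j, i ≠ j → ∀ s t, s < t → f i s = f j s → f i t = f j t → s + 1 ≤ t)
    (g : ℕ) (a b : ℝ) (hab : a < b) (hKa : KE f g a) (hKb : KE f g b)
    (hno : ∀ t ∈ Set.Ioo a b, ¬ KE f g t) : ∃ t ∈ Set.Ioo a b, SE f g t := by
  by_contra! hS
  obtain ⟨ya, ha2, ha3, ha4⟩ := hKa
  obtain ⟨yb, hb2, hb3, hb4⟩ := hKb
  have hgd : g < d := lt_of_lt_of_le ha4 (mle_le f a ya)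
  have P1 : ∀ t ∈ Set.Ioo a b, ¬ PE f (g-1) t := by
    rintro t ht ⟨y, h2, h3, h4⟩
    by_cases h : mle f t y = g
    · exact hS t ht ⟨y, h2, Or.inr h⟩
    · exact hno t ht ⟨y, h2, by omega, by omega⟩
  have P2 : ∀ t ∈ Set.Ioo a b, ¬ PE f g t := by
    rintro t ht ⟨y, h2, h3, h4⟩
    by_cases h : mlo f t y = g
    · exact hS t ht ⟨y, h2, Or.inl h⟩
    · exact hno t ht ⟨y, h2, by omega, by omega⟩
  obtain ⟨x, hx⟩ := track f hc (g-1) (by omega) a b hab P1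
  obtain ⟨w, hw⟩ := track f hc g hgd a b hab P2
  have hx' : ∀ t ∈ Set.Ioo a b, mlo f t (f x t) = g-1 ∧ mle f t (f x t) = g-1 + 1 :=
    fun t ht => ⟨(hx t ht).1, (hx t ht).2.1⟩
  have hw' : ∀ t ∈ Set.Ioo a b, mlo f t (f w t) = g ∧ mle f t (f w t) = g + 1 :=
    fun t ht => ⟨(hw t ht).1, (hw t ht).2.1⟩
  have hmid : (a+b)/2 ∈ Set.Ioo a b := ⟨by linarith, by linarith⟩
  have hxw : x ≠ w := by
    rintro rfl
    have h1 := (hx _ hmid).1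
    have h2 := (hw _ hmid).1
    omega
  have xa := track_end f hc (g-1) a b hab x hx' a ⟨le_rfl, hab.le⟩ ya (by omega) (by omega)
  have wa := track_end f hc g a b hab w hw' a ⟨le_rfl, hab.le⟩ ya (by omega) (by omega)
  have xb := track_end f hc (g-1) a b hab x hx' b ⟨hab.le, le_rfl⟩ yb (by omega) (by omega)
  have wb := track_end f hc g a b hab w hw' b ⟨hab.le, le_rfl⟩ yb (by omega) (by omega)
  have := hz x w hxw a b hab (by rw [xa, wa]) (by rw [xb, wb])
  exact no_isolated f hc ha hn a b this x (fun t ht => (hx t ht).2.2)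

lemma outer_side {d : ℕ} (f : Fin d → ℝ → ℝ) (hc : ∀ i, Continuous (f i))
    (ha : ∀ i t, f i (t + 1) = - f i t) (hn : ∀ t y, ∃ i, f i t ≠ y)
    (g : ℕ) (hg : g = 0 ∨ g = d) (a : ℝ) : ∃ t ∈ Set.Ioo a (a+1), SE f g t := by
  by_contra! hS
  have hd : 0 < d := by
    obtain ⟨i, -⟩ := hn 0 0
    exact lt_of_le_of_lt (Nat.zero_le _) i.2
  have : ∃ p, p < d ∧ ∀ t ∈ Set.Ioo a (a+1), ¬ PE f p t := by
    rcases hg with hg | hg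
    · refine ⟨0, hd, ?_⟩
      rintro t ht ⟨y, h2, h3, h4⟩
      exact hS t ht ⟨y, h2, Or.inl (by omega)⟩
    · refine ⟨d - 1, by omega, ?_⟩
      rintro t ht ⟨y, h2, h3, h4⟩
      have := mle_le f t y
      exact hS t ht ⟨y, h2, Or.inr (by omega)⟩
  obtain ⟨p, hp, hP⟩ := this
  obtain ⟨x, hx⟩ := track f hc p hp a (a+1) (by linarith) hP
  exact no_isolated f hc ha hn a (a+1) le_rfl x (fun t ht => (hx t ht).2.2)

lemma mmu_add_one {d : ℕ} (f : Fin d → ℝ → ℝ) (ha : ∀ i t, f i (t + 1) = - f i t) (t y : ℝ) :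
    mmu f (t+1) (-y) = mmu f t y := by
  unfold mmu
  congr 1
  ext i
  simp [ha]

lemma per2 {d : ℕ} (f : Fin d → ℝ → ℝ) (ha : ∀ i t, f i (t + 1) = - f i t) (i : Fin d) (t : ℝ) :
    f i (t + 2) = f i t := by
  have : t + 2 = (t + 1) + 1 := by ring
  rw [this, ha, ha, neg_neg]

lemma KE_add_two {d : ℕ} (f : Fin d → ℝ → ℝ) (ha : ∀ i t, f i (t + 1) = - f i t) (g : ℕ) (t : ℝ) :
    KE f g (t + 2) ↔ KE f g t := by
  simp only [KE, mmu, mlo, mle, per2 f ha]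

lemma SE_add_two {d : ℕ} (f : Fin d → ℝ → ℝ) (ha : ∀ i t, f i (t + 1) = - f i t) (g : ℕ) (t : ℝ) :
    SE f g (t + 2) ↔ SE f g t := by
  simp only [SE, mmu, mlo, mle, per2 f ha]

lemma finite_vertices {d : ℕ} (f : Fin d → ℝ → ℝ)
    (hz : ∀ i j, i ≠ j → ∀ s t, s < t → f i s = f j s → f i t = f j t → s + 1 ≤ t) :
    {v : ℝ × ℝ | 0 ≤ v.1 ∧ v.1 < 2 ∧ 2 ≤ mmu f v.1 v.2}.Finite := by
  have h1 : ∀ i j, i ≠ j → {t : ℝ | 0 ≤ t ∧ t < 2 ∧ f i t = f j t}.Finite := by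
    intro i j hij
    apply Set.Finite.of_finite_image (f := fun t : ℝ => ⌊t⌋)
    · apply (Set.finite_Icc (0:ℤ) 2).subset
      rintro _ ⟨t, ⟨h0, h2, -⟩, rfl⟩
      refine ⟨Int.floor_nonneg.mpr h0, ?_⟩
      have : (⌊t⌋ : ℝ) ≤ t := Int.floor_le t
      have h3 : (⌊t⌋ : ℝ) ≤ (2 : ℤ) := by push_cast; linarith
      exact_mod_cast h3
    · rintro s ⟨_, _, hs⟩ t ⟨_, _, ht⟩ hst
      have hst' : ⌊s⌋ = ⌊t⌋ := hst
      have := Int.abs_sub_lt_one_of_floor_eq_floor hst'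
      rw [abs_lt] at this
      rcases lt_trichotomy s t with h | h | h
      · linarith [hz i j hij s t h hs ht]
      · exact h
      · linarith [hz i j hij t s h ht hs]
  have h2 : (⋃ i : Fin d, ⋃ j : Fin d, ⋃ _ : i ≠ j, (fun t => (t, f i t)) ''
      {t : ℝ | 0 ≤ t ∧ t < 2 ∧ f i t = f j t}).Finite :=
    Set.finite_iUnion fun i => Set.finite_iUnion fun j => Set.finite_iUnion fun h =>
      (h1 i j h).image _
  apply h2.subset
  rintro ⟨t, y⟩ ⟨h0, h2, hm⟩
  obtain ⟨i, hi, j, hj, hij⟩ := Finset.one_lt_card.mp (show 1 < _ from hm)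
  simp at hi hj
  simp only [Set.mem_iUnion]
  exact ⟨i, j, hij, t, ⟨h0, h2, by rw [hi, hj]⟩, by simp [hi]⟩

lemma pseudo_count {d : ℕ} (f : Fin d → ℝ → ℝ) (hc : ∀ i, Continuous (f i))
    (ha : ∀ i t, f i (t + 1) = - f i t) (hn : ∀ t y, ∃ i, f i t ≠ y)
    (hz : ∀ i j, i ≠ j → ∀ s t, s < t → f i s = f j s → f i t = f j t → s + 1 ≤ t)
    (W : Finset (ℝ × ℝ)) (hW : ∀ v, v ∈ W ↔ 0 ≤ v.1 ∧ v.1 < 2 ∧ 2 ≤ mmu f v.1 v.2) :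
    ∑ v ∈ W, (mmu f v.1 v.2 - 1) + 6 ≤ 2 * W.card := by
  classical
  have hd : 0 < d := by
    obtain ⟨i, -⟩ := hn 0 0
    exact lt_of_le_of_lt (Nat.zero_le _) i.2
  let T := W.image Prod.fst
  let Kt : ℕ → Finset ℝ := fun g => T.filter (KE f g)
  let St : ℕ → Finset ℝ := fun g => T.filter (SE f g)
  have hKt : ∀ g t, t ∈ Kt g ↔ 0 ≤ t ∧ t < 2 ∧ KE f g t := by
    intro g t
    simp only [Kt, T, Finset.mem_filter, Finset.mem_image, hW]
    constructor
    · rintro ⟨⟨v, ⟨h1, h2, h3⟩, rfl⟩, h⟩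
      exact ⟨h1, h2, h⟩
    · rintro ⟨h1, h2, h⟩
      obtain ⟨y, hy, -⟩ := id h
      exact ⟨⟨(t, y), ⟨h1, h2, hy⟩, rfl⟩, h⟩
  have hSt : ∀ g t, t ∈ St g ↔ 0 ≤ t ∧ t < 2 ∧ SE f g t := by
    intro g t
    simp only [St, T, Finset.mem_filter, Finset.mem_image, hW]
    constructor
    · rintro ⟨⟨v, ⟨h1, h2, h3⟩, rfl⟩, h⟩
      exact ⟨h1, h2, h⟩
    · rintro ⟨h1, h2, h⟩
      obtain ⟨y, hy, -⟩ := id h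
      exact ⟨⟨(t, y), ⟨h1, h2, hy⟩, rfl⟩, h⟩
  -- sum of multiplicities
  have hA : ∑ v ∈ W, (mmu f v.1 v.2 - 1) ≤ ∑ g ∈ Finset.range (d+1), (Kt g).card := by
    have e1 : ∀ v ∈ W, mmu f v.1 v.2 - 1 =
        ∑ g ∈ Finset.range (d+1), if mlo f v.1 v.2 < g ∧ g < mle f v.1 v.2 then 1 else 0 := by
      intro v _
      rw [← Finset.card_filter]
      have : (Finset.range (d+1)).filter (fun g => mlo f v.1 v.2 < g ∧ g < mle f v.1 v.2)
          = Finset.Ioo (mlo f v.1 v.2) (mle f v.1 v.2) := by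
        ext g
        have := mle_le f v.1 v.2
        simp
        omega
      rw [this, Nat.card_Ioo, mle_eq]
      omega
    rw [Finset.sum_congr rfl e1, Finset.sum_comm]
    apply Finset.sum_le_sum
    intro g _
    rw [← Finset.card_filter]
    apply Finset.card_le_card_of_injOn Prod.fst
    · intro v hv
      simp only [Finset.coe_filter, Set.mem_ofPred_eq, hW] at hv
      simp only [Finset.mem_coe, hKt]
      exact ⟨hv.1.1, hv.1.2.1, v.2, hv.1.2.2, hv.2⟩
    · rintro ⟨t, y⟩ hv ⟨t', y'⟩ hv' htt
      simp only [Finset.coe_filter, Set.mem_ofPred_eq] at hv hv' htt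
      subst htt
      rcases lt_trichotomy y y' with h | h | h
      · have := mle_le_mlo f t h
        omega
      · rw [h]
      · have := mle_le_mlo f t h
        omega
  have hB : ∑ g ∈ Finset.range (d+1), (St g).card ≤ 2 * W.card := by
    have e1 : ∀ g ∈ Finset.range (d+1), (St g).card ≤
        (W.filter (fun v => mlo f v.1 v.2 = g)).card
          + (W.filter (fun v => mle f v.1 v.2 = g)).card := by
      intro g _
      have : St g ⊆ ((W.filter (fun v => mlo f v.1 v.2 = g)) ∪
          (W.filter (fun v => mle f v.1 v.2 = g))).image Prod.fst := by
        intro t ht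
        rw [hSt] at ht
        obtain ⟨h0, h2, y, hy, h⟩ := ht
        rw [Finset.mem_image]
        refine ⟨(t, y), ?_, rfl⟩
        simp only [Finset.mem_union, Finset.mem_filter, hW]
        rcases h with h | h
        · exact Or.inl ⟨⟨h0, h2, hy⟩, h⟩
        · exact Or.inr ⟨⟨h0, h2, hy⟩, h⟩
      exact (Finset.card_le_card this).trans (Finset.card_image_le.trans (Finset.card_union_le _ _))
    refine (Finset.sum_le_sum e1).trans ?_
    rw [Finset.sum_add_distrib, ← Finset.card_eq_sum_card_fiberwise,
      ← Finset.card_eq_sum_card_fiberwise]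
    · omega
    · intro v _
      have := mle_le f v.1 v.2
      simp
      omega
    · intro v _
      have := mle_le f v.1 v.2
      have := mle_eq f v.1 v.2
      simp
      omega
  have hC : ∀ g, (Kt g).card ≤ (St g).card := by
    intro g
    rcases (Kt g).eq_empty_or_nonempty with h0 | hne
    · simp [h0]
    have hlast := (Kt g).max'_mem hne
    have hfirst := (Kt g).min'_mem hne
    set b := (Kt g).max' hne with hb
    set a := (Kt g).min' hne with ha'
    rw [hKt] at hlast hfirst
    obtain ⟨s, hs, hSs⟩ := side_between f hc ha hn hz g b (a+2) (by linarith) hlast.2.2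
      ((KE_add_two f ha g a).mpr hfirst.2.2) (by
        intro t ht hK
        by_cases h2 : t < 2
        · have := (Kt g).le_max' t ((hKt g t).mpr ⟨by linarith [ht.1], h2, hK⟩)
          linarith [ht.1]
        · have hK' : KE f g (t - 2) := by
            rw [← KE_add_two f ha]; simpa using hK
          have := (Kt g).min'_le (t-2) ((hKt g _).mpr ⟨by linarith, by linarith [ht.2], hK'⟩)
          linarith [ht.2])
    have : ∃ s' ∈ St g, b < s' ∨ s' < a := by
      by_cases h2 : s < 2
      · exact ⟨s, (hSt g s).mpr ⟨by linarith [hs.1], h2, hSs⟩, Or.inl hs.1⟩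
      · have hS' : SE f g (s - 2) := by
          rw [← SE_add_two f ha]; simpa using hSs
        exact ⟨s - 2, (hSt g _).mpr ⟨by linarith, by linarith [hs.2], hS'⟩,
          Or.inr (by linarith [hs.2])⟩
    obtain ⟨s', hs', hside⟩ := this
    have hcardle : (Kt g).card ≤ ((St g).erase s').card + 1 := by
      apply Finset.card_le_of_interleaved
      intro x hx y hy hxy hnone
      have hxa : a ≤ x := (Kt g).min'_le x hx
      have hyb : y ≤ b := (Kt g).le_max' y hy
      rw [hKt] at hx hy
      obtain ⟨r, hr, hSr⟩ := side_between f hc ha hn hz g x y hxy hx.2.2 hy.2.2 (by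
        intro t ht hK
        exact hnone t ((hKt g t).mpr ⟨by linarith [ht.1], by linarith [ht.2], hK⟩) ht)
      refine ⟨r, ?_, hr.1, hr.2⟩
      rw [Finset.mem_erase]
      refine ⟨?_, (hSt g r).mpr ⟨by linarith [hr.1], by linarith [hr.2], hSr⟩⟩
      rintro rfl
      rcases hside with h | h
      · linarith [hr.2]
      · linarith [hr.1]
    rw [Finset.card_erase_of_mem hs'] at hcardle
    have := Finset.card_pos.mpr ⟨s', hs'⟩
    omega
  have hD : ∀ g, (g = 0 ∨ g = d) → (Kt g).card + 3 ≤ (St g).card := by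
    intro g hg
    have hK0 : (Kt g).card = 0 := by
      rw [Finset.card_eq_zero, Finset.eq_empty_iff_forall_notMem]
      intro t ht
      rw [hKt] at ht
      obtain ⟨-, -, y, -, h1, h2⟩ := ht
      have := mle_le f t y
      omega
    obtain ⟨s1, h1, hS1⟩ := outer_side f hc ha hn g hg 0
    obtain ⟨s2, h2, hS2⟩ := outer_side f hc ha hn g hg s1
    obtain ⟨s3, h3, hS3⟩ := outer_side f hc ha hn g hg (s1+1)
    have e1 : s1 ∈ St g := (hSt g s1).mpr ⟨h1.1.le, by linarith [h1.2], hS1⟩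
    have e2 : s2 ∈ St g := (hSt g s2).mpr ⟨by linarith [h1.1, h2.1], by linarith [h1.2, h2.2], hS2⟩
    have : ∃ s ∈ St g, s ≠ s1 ∧ s ≠ s2 := by
      by_cases hlt : s3 < 2
      · refine ⟨s3, (hSt g s3).mpr ⟨by linarith [h1.1, h3.1], hlt, hS3⟩, ?_, ?_⟩
        · intro h; linarith [h3.1]
        · intro h; linarith [h3.1, h2.2]
      · have hS' : SE f g (s3 - 2) := by
          rw [← SE_add_two f ha]; simpa using hS3
        refine ⟨s3 - 2, (hSt g _).mpr ⟨by linarith, by linarith [h1.2, h3.2], hS'⟩, ?_, ?_⟩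
        · intro h; linarith [h3.2]
        · intro h; linarith [h3.2, h2.1]
    obtain ⟨s, hs, hs1, hs2⟩ := this
    have hsub : ({s, s1, s2} : Finset ℝ) ⊆ St g := by
      intro r hr
      simp at hr
      rcases hr with rfl | rfl | rfl <;> assumption
    have hcard := Finset.card_le_card hsub
    have h12 : s1 ≠ s2 := h2.1.ne
    rw [Finset.card_eq_three.mpr ⟨s, s1, s2, hs1, hs2, h12, rfl⟩] at hcard
    omega
  have hE : ∑ g ∈ Finset.range (d+1), (Kt g).card + 6 ≤ ∑ g ∈ Finset.range (d+1), (St g).card := by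
    obtain ⟨e, rfl⟩ : ∃ e, d = e + 1 := ⟨d - 1, by omega⟩
    rw [Finset.sum_range_succ, Finset.sum_range_succ', Finset.sum_range_succ _ (e+1),
      Finset.sum_range_succ' _ e]
    have := hD 0 (Or.inl rfl)
    have := hD (e+1) (Or.inr rfl)
    have : ∑ g ∈ Finset.range e, (Kt (g+1)).card ≤ ∑ g ∈ Finset.range e, (St (g+1)).card :=
      Finset.sum_le_sum fun g _ => hC _
    omega
  omega

end Pseudo

section Transfer

/-- the vector with coordinates `y` along `(1,s,s^2)` and direction angle `π t` in the last two. -/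
noncomputable def mvec (s t y : ℝ) : Fin 3 → ℝ :=
  ![y, y * s + Real.cos (Real.pi * t), y * s ^ 2 + Real.sin (Real.pi * t)]

lemma mvec_ne_zero (s t y : ℝ) : mvec s t y ≠ 0 := by
  intro h
  have h0 := congrFun h 0
  have h1 := congrFun h 1
  have h2 := congrFun h 2
  simp [mvec] at h0 h1 h2
  subst h0
  simp at h1 h2
  have := Real.sin_sq_add_cos_sq (Real.pi * t)
  rw [h1, h2] at this
  norm_num at this

lemma exists_generic {d : ℕ} (L : Fin d → (Fin 3 → ℝ)) (hL0 : ∀ i, L i ≠ 0) :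
    ∃ s : ℝ, ∀ i, L i 0 + L i 1 * s + L i 2 * s ^ 2 ≠ 0 := by
  let p : Fin d → Polynomial ℝ := fun i =>
    Polynomial.C (L i 0) + Polynomial.C (L i 1) * Polynomial.X
      + Polynomial.C (L i 2) * Polynomial.X ^ 2
  have hp : ∀ i, p i ≠ 0 := by
    intro i h
    apply hL0 i
    have c0 := congrArg (fun q => Polynomial.coeff q 0) h
    have c1 := congrArg (fun q => Polynomial.coeff q 1) h
    have c2 := congrArg (fun q => Polynomial.coeff q 2) h
    simp [p, Polynomial.coeff_X, Polynomial.coeff_C, Polynomial.coeff_X_pow] at c0 c1 c2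
    ext j
    fin_cases j <;> simp [c0, c1, c2]
  have hprod : ∏ i, p i ≠ 0 := Finset.prod_ne_zero_iff.mpr fun i _ => hp i
  obtain ⟨s, hs⟩ := Polynomial.exists_eval_ne_zero_of_natDegree_lt_card (R := ℝ) (∏ i, p i) hprod
    (by
      rw [Cardinal.mk_real]
      exact (Cardinal.natCast_lt_aleph0).trans_le Cardinal.aleph0_le_continuum)
  rw [Polynomial.eval_prod, Finset.prod_ne_zero_iff] at hs
  refine ⟨s, fun i => ?_⟩
  have := hs i (Finset.mem_univ _)
  simpa [p] using this

/-- the curves. -/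
noncomputable def mcurve {d : ℕ} (L : Fin d → (Fin 3 → ℝ)) (s : ℝ) (i : Fin d) (t : ℝ) : ℝ :=
  -(L i 1 * Real.cos (Real.pi * t) + L i 2 * Real.sin (Real.pi * t)) /
    (L i 0 + L i 1 * s + L i 2 * s ^ 2)

lemma mcurve_iff {d : ℕ} (L : Fin d → (Fin 3 → ℝ)) (s : ℝ)
    (hs : ∀ i, L i 0 + L i 1 * s + L i 2 * s ^ 2 ≠ 0) (i : Fin d) (t y : ℝ) :
    mcurve L s i t = y ↔ ∑ j, L i j * mvec s t y j = 0 := by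
  unfold mcurve mvec
  rw [div_eq_iff (hs i), Fin.sum_univ_three]
  simp
  constructor <;> intro h <;> linarith

lemma mcurve_zero {d : ℕ} (L : Fin d → (Fin 3 → ℝ)) (s : ℝ)
    (hs : ∀ i, L i 0 + L i 1 * s + L i 2 * s ^ 2 ≠ 0)
    (hLdist : ∀ i j, i ≠ j → ∀ c : ℝ, L i ≠ c • L j) (i j : Fin d) (hij : i ≠ j)
    (a b : ℝ) (hab : a < b) (h1 : mcurve L s i a = mcurve L s j a)
    (h2 : mcurve L s i b = mcurve L s j b) : a + 1 ≤ b := by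
  by_contra! hlt
  have hsin : 0 < Real.sin (Real.pi * b - Real.pi * a) := by
    apply Real.sin_pos_of_pos_of_lt_pi
    · nlinarith [Real.pi_pos]
    · nlinarith [Real.pi_pos]
  rw [Real.sin_sub] at hsin
  have hi := hs i
  have hj := hs j
  apply hLdist i j hij ((L i 0 + L i 1 * s + L i 2 * s ^ 2) / (L j 0 + L j 1 * s + L j 2 * s ^ 2))
  unfold mcurve at h1 h2
  set ci := L i 0 + L i 1 * s + L i 2 * s ^ 2 with hci
  set cj := L j 0 + L j 1 * s + L j 2 * s ^ 2 with hcj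
  rw [div_eq_div_iff hi hj] at h1 h2
  set A := L i 1 * cj - L j 1 * ci with hA
  set B := L i 2 * cj - L j 2 * ci with hB
  have h1' : A * Real.cos (Real.pi * a) + B * Real.sin (Real.pi * a) = 0 := by
    rw [hA, hB]; linarith
  have h2' : A * Real.cos (Real.pi * b) + B * Real.sin (Real.pi * b) = 0 := by
    rw [hA, hB]; linarith
  have hA0 : A = 0 := by
    have : A * (Real.sin (Real.pi * b) * Real.cos (Real.pi * a)
      - Real.cos (Real.pi * b) * Real.sin (Real.pi * a)) = 0 := by
      linear_combination Real.sin (Real.pi * b) * h1' - Real.sin (Real.pi * a) * h2'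
    exact (mul_eq_zero.mp this).resolve_right hsin.ne'
  have hB0 : B = 0 := by
    have : B * (Real.sin (Real.pi * b) * Real.cos (Real.pi * a)
      - Real.cos (Real.pi * b) * Real.sin (Real.pi * a)) = 0 := by
      linear_combination Real.cos (Real.pi * a) * h2' - Real.cos (Real.pi * b) * h1'
    exact (mul_eq_zero.mp this).resolve_right hsin.ne'
  have e1 : L i 1 * cj = ci * L j 1 := by linarith
  have e2 : L i 2 * cj = ci * L j 2 := by linarith
  have e0 : L i 0 * cj = ci * L j 0 := by
    have : L i 0 = ci - L i 1 * s - L i 2 * s ^ 2 := by rw [hci]; ring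
    have h' : L j 0 = cj - L j 1 * s - L j 2 * s ^ 2 := by rw [hcj]; ring
    rw [this, h']
    linear_combination -s * e1 - s^2 * e2
  ext k
  rw [Pi.smul_apply, smul_eq_mul, div_mul_eq_mul_div, eq_div_iff hj]
  fin_cases k
  · exact e0
  · exact e1
  · exact e2

lemma exists_polar (X Z : ℝ) (h : ¬ (X = 0 ∧ Z = 0)) :
    ∃ r t : ℝ, r ≠ 0 ∧ 0 ≤ t ∧ t < 1 ∧ X = r * Real.cos (Real.pi * t) ∧
      Z = r * Real.sin (Real.pi * t) := by
  have hz : (⟨X, Z⟩ : ℂ) ≠ 0 := by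
    intro h'
    exact h ⟨congrArg Complex.re h', congrArg Complex.im h'⟩
  have hr := norm_pos_iff.mpr hz
  set z : ℂ := ⟨X, Z⟩ with hzdef
  have hc : X = ‖z‖ * Real.cos (Complex.arg z) := (Complex.norm_mul_cos_arg z).symm
  have hs : Z = ‖z‖ * Real.sin (Complex.arg z) := (Complex.norm_mul_sin_arg z).symm
  have hpi := Real.pi_pos
  have h1 := Complex.neg_pi_lt_arg z
  have h2 := Complex.arg_le_pi z
  by_cases h3 : Complex.arg z < 0
  · refine ⟨-‖z‖, Complex.arg z / Real.pi + 1, neg_ne_zero.mpr hr.ne', ?_, ?_, ?_, ?_⟩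
    · have : -1 < Complex.arg z / Real.pi := by rw [lt_div_iff₀ hpi]; linarith
      linarith
    · have : Complex.arg z / Real.pi < 0 := div_neg_of_neg_of_pos h3 hpi
      linarith
    · have : Real.pi * (Complex.arg z / Real.pi + 1) = Complex.arg z + Real.pi := by field_simp
      rw [this, Real.cos_add_pi]; linarith
    · have : Real.pi * (Complex.arg z / Real.pi + 1) = Complex.arg z + Real.pi := by field_simp
      rw [this, Real.sin_add_pi]; linarith
  · by_cases h4 : Complex.arg z = Real.pi
    · refine ⟨-‖z‖, 0, neg_ne_zero.mpr hr.ne', le_rfl, one_pos, ?_, ?_⟩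
      · rw [h4, Real.cos_pi] at hc
        simp; linarith
      · rw [h4, Real.sin_pi] at hs
        simp; linarith
    · have h5 : Complex.arg z < Real.pi := lt_of_le_of_ne h2 h4
      have : Real.pi * (Complex.arg z / Real.pi) = Complex.arg z := by field_simp
      refine ⟨‖z‖, Complex.arg z / Real.pi, hr.ne', div_nonneg (not_lt.mp h3) hpi.le, ?_, ?_, ?_⟩
      · rw [div_lt_one hpi]; exact h5
      · rw [this]; exact hc
      · rw [this]; exact hs

/-- the projective point of `(t, y)` -/
noncomputable def mpt (s : ℝ) (v : ℝ × ℝ) : Projectivization ℝ (Fin 3 → ℝ) :=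
  Projectivization.mk ℝ (mvec s v.1 v.2) (mvec_ne_zero s v.1 v.2)

lemma mpt_count {d : ℕ} (L : Fin d → (Fin 3 → ℝ)) (s : ℝ)
    (hs : ∀ i, L i 0 + L i 1 * s + L i 2 * s ^ 2 ≠ 0) (v : ℝ × ℝ) :
    Nat.card {i : Fin d | ∑ j, L i j * (mpt s v).rep j = 0} = mmu (mcurve L s) v.1 v.2 := by
  obtain ⟨a, ha⟩ := Projectivization.exists_smul_eq_mk_rep ℝ (mvec s v.1 v.2)
    (mvec_ne_zero s v.1 v.2)
  have : ∀ i, ∑ j, L i j * (mpt s v).rep j = 0 ↔ mcurve L s i v.1 = v.2 := by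
    intro i
    rw [mcurve_iff L s hs]
    unfold mpt
    rw [← ha]
    have e : ∑ j, L i j * (a • mvec s v.1 v.2) j = (a : ℝ) * ∑ j, L i j * mvec s v.1 v.2 j := by
      rw [Finset.mul_sum]
      apply Finset.sum_congr rfl
      intro j _
      rw [Pi.smul_apply, Units.smul_def, smul_eq_mul]
      ring
    rw [e, mul_eq_zero]
    simp
  unfold mmu
  rw [Nat.card_coe_set_eq, ← Set.ncard_coe_finset]
  congr 1
  ext i
  simp [this]

lemma mpt_injOn (s : ℝ) : Set.InjOn (mpt s) {v | 0 ≤ v.1 ∧ v.1 < 1} := by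
  rintro ⟨t, y⟩ ⟨h0, h1⟩ ⟨t', y'⟩ ⟨h0', h1'⟩ h
  simp only at h0 h1 h0' h1'
  unfold mpt at h
  rw [Projectivization.mk_eq_mk_iff'] at h
  obtain ⟨a, ha⟩ := h
  have e0 := congrFun ha 0
  have e1 := congrFun ha 1
  have e2 := congrFun ha 2
  simp [mvec] at e0 e1 e2
  have c1 : a * Real.cos (Real.pi * t') = Real.cos (Real.pi * t) := by
    linear_combination e1 - s * e0
  have c2 : a * Real.sin (Real.pi * t') = Real.sin (Real.pi * t) := by
    linear_combination e2 - s ^ 2 * e0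
  have hsin : Real.sin (Real.pi * t - Real.pi * t') = 0 := by
    rw [Real.sin_sub, ← c1, ← c2]; ring
  have hpi := Real.pi_pos
  have := (Real.sin_eq_zero_iff_of_lt_of_lt (by nlinarith) (by nlinarith)).mp hsin
  have htt : t = t' := by
    have : Real.pi * (t - t') = 0 := by linarith
    rcases mul_eq_zero.mp this with h | h <;> linarith
  subst htt
  have ha1 : a = 1 := by
    have := Real.sin_sq_add_cos_sq (Real.pi * t)
    linear_combination (1 - a) * this + Real.cos (Real.pi * t) * c1 + Real.sin (Real.pi * t) * c2
  subst ha1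
  simp at e0
  rw [e0]

lemma mpt_surj {d : ℕ} (L : Fin d → (Fin 3 → ℝ)) (s : ℝ)
    (hs : ∀ i, L i 0 + L i 1 * s + L i 2 * s ^ 2 ≠ 0) (P : Projectivization ℝ (Fin 3 → ℝ))
    (i : Fin d) (hi : ∑ j, L i j * P.rep j = 0) :
    ∃ v : ℝ × ℝ, 0 ≤ v.1 ∧ v.1 < 1 ∧ mpt s v = P := by
  rw [Fin.sum_univ_three] at hi
  have hne : ¬ (P.rep 1 - P.rep 0 * s = 0 ∧ P.rep 2 - P.rep 0 * s ^ 2 = 0) := by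
    rintro ⟨h1, h2⟩
    have hp : P.rep 0 * (L i 0 + L i 1 * s + L i 2 * s ^ 2) = 0 := by
      linear_combination hi - L i 1 * h1 - L i 2 * h2
    have h0 := (mul_eq_zero.mp hp).resolve_right (hs i)
    apply P.rep_nonzero
    rw [h0] at h1 h2
    ext j
    fin_cases j
    · exact h0
    · simpa using h1
    · simpa using h2
  obtain ⟨r, t, hr, ht0, ht1, hX, hZ⟩ := exists_polar _ _ hne
  refine ⟨(t, P.rep 0 / r), ht0, ht1, ?_⟩
  conv_rhs => rw [← P.mk_rep]
  unfold mpt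
  rw [Projectivization.mk_eq_mk_iff']
  refine ⟨r⁻¹, ?_⟩
  ext j
  fin_cases j
  · simp [mvec]; field_simp
  · simp [mvec]; field_simp; linarith
  · simp [mvec]; field_simp; linarith

end Transfer

theorem melchior_inequality (d : ℕ) (hd : 3 ≤ d)
    (L : Fin d → (Fin 3 → ℝ))
    (hL0 : ∀ i, L i ≠ 0)
    (hLdist : ∀ i j, i ≠ j → ∀ c : ℝ, L i ≠ c • L j)
    (hconc : ¬ ∃ v : Fin 3 → ℝ, v ≠ 0 ∧ ∀ i, ∑ j, L i j * v j = 0)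
    (t : ℕ → ℕ)
    (ht : ∀ k, t k = Nat.card {P : Projectivization ℝ (Fin 3 → ℝ) |
        Nat.card {i : Fin d | ∑ j, L i j * P.rep j = 0} = k}) :
    3 + ∑ k ∈ Finset.Icc 3 d, t k * (k - 3) ≤ t 2 := by
  classical
  obtain ⟨s, hs⟩ := exists_generic L hL0
  set f := mcurve L s with hf
  have hc : ∀ i, Continuous (f i) := by
    intro i
    rw [hf]
    unfold mcurve
    fun_prop
  have ha : ∀ i t, f i (t + 1) = - f i t := by
    intro i t
    rw [hf]
    unfold mcurve
    rw [mul_add, mul_one, Real.cos_add_pi, Real.sin_add_pi]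
    ring
  have hn : ∀ t y, ∃ i, f i t ≠ y := by
    intro t y
    by_contra! hcon
    exact hconc ⟨mvec s t y, mvec_ne_zero s t y, fun i => (mcurve_iff L s hs i t y).mp (hcon i)⟩
  have hz : ∀ i j, i ≠ j → ∀ s t, s < t → f i s = f j s → f i t = f j t → s + 1 ≤ t :=
    fun i j hij a b hab h1 h2 => mcurve_zero L s hs hLdist i j hij a b hab h1 h2
  have hfin := finite_vertices f hz
  set W := hfin.toFinset with hWdef
  have hW : ∀ v, v ∈ W ↔ 0 ≤ v.1 ∧ v.1 < 2 ∧ 2 ≤ mmu f v.1 v.2 := by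
    intro v
    rw [hWdef, Set.Finite.mem_toFinset]
    rfl
  have hmain := pseudo_count f hc ha hn hz W hW
  set H := W.filter (fun v => v.1 < 1) with hH
  have hHm : ∀ v, v ∈ H ↔ 0 ≤ v.1 ∧ v.1 < 1 ∧ 2 ≤ mmu f v.1 v.2 := by
    intro v
    rw [hH, Finset.mem_filter, hW]
    constructor
    · rintro ⟨⟨h1, h2, h3⟩, h4⟩
      exact ⟨h1, h4, h3⟩
    · rintro ⟨h1, h2, h3⟩
      exact ⟨⟨h1, by linarith, h3⟩, h2⟩
  -- full period is twice the half period
  have hdouble : ∀ F : ℕ → ℤ, ∑ v ∈ W, F (mmu f v.1 v.2) = 2 * ∑ v ∈ H, F (mmu f v.1 v.2) := by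
    intro F
    rw [← Finset.sum_filter_add_sum_filter_not W (fun v => v.1 < 1), two_mul]
    congr 1
    symm
    apply Finset.sum_nbij' (fun v => (v.1 + 1, -v.2)) (fun v => (v.1 - 1, -v.2))
    · intro v hv
      rw [hHm] at hv
      rw [Finset.mem_filter, hW]
      simp only [mmu_add_one f ha]
      exact ⟨⟨by linarith [hv.1], by linarith [hv.2.1], hv.2.2⟩, by linarith [hv.1]⟩
    · intro v hv
      rw [Finset.mem_filter, hW] at hv
      rw [hHm]
      have := mmu_add_one f ha (v.1 - 1) (-v.2)
      rw [sub_add_cancel, neg_neg] at this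
      simp only [← this]
      exact ⟨by linarith [not_lt.mp hv.2], by linarith [hv.1.2.1], hv.1.2.2⟩
    · intro v _
      simp
    · intro v _
      simp
    · intro v _
      rw [mmu_add_one f ha]
  have hhalf : (3 : ℤ) ≤ ∑ v ∈ H, (3 - (mmu f v.1 v.2 : ℤ)) := by
    have h1 := hdouble (fun m => 3 - (m : ℤ))
    have h2 : ∑ v ∈ W, (3 - (mmu f v.1 v.2 : ℤ))
        = 2 * (W.card : ℤ) - ((∑ v ∈ W, (mmu f v.1 v.2 - 1) : ℕ) : ℤ) := by
      rw [Nat.cast_sum, Finset.card_eq_sum_ones, Nat.cast_sum, Finset.mul_sum,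
        ← Finset.sum_sub_distrib]
      apply Finset.sum_congr rfl
      intro v hv
      have := ((hW v).mp hv).2.2
      omega
    have h3 : ((∑ v ∈ W, (mmu f v.1 v.2 - 1) : ℕ) : ℤ) + 6 ≤ 2 * (W.card : ℤ) := by
      exact_mod_cast hmain
    linarith
  -- counting projective points
  have htk : ∀ k, 2 ≤ k → t k = (H.filter (fun v => mmu f v.1 v.2 = k)).card := by
    intro k hk
    rw [ht k, Nat.card_coe_set_eq, ← Set.ncard_coe_finset]
    have himg : {P : Projectivization ℝ (Fin 3 → ℝ) |
        Nat.card {i : Fin d | ∑ j, L i j * P.rep j = 0} = k}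
        = mpt s '' (H.filter (fun v => mmu f v.1 v.2 = k) : Finset (ℝ × ℝ)) := by
      ext P
      constructor
      · intro hP
        have hP' : Nat.card {i : Fin d | ∑ j, L i j * P.rep j = 0} = k := hP
        have hne : Nonempty {i : Fin d | ∑ j, L i j * P.rep j = 0} := by
          by_contra hemp
          rw [not_nonempty_iff] at hemp
          rw [Nat.card_of_isEmpty] at hP'
          omega
        obtain ⟨i, hi⟩ := hne
        obtain ⟨v, h0, h1, rfl⟩ := mpt_surj L s hs P i hi
        rw [mpt_count L s hs] at hP'
        refine ⟨v, ?_, rfl⟩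
        rw [Finset.mem_coe, Finset.mem_filter, hHm]
        exact ⟨⟨h0, h1, by rw [hf]; omega⟩, hP'⟩
      · rintro ⟨v, hv, rfl⟩
        rw [Finset.mem_coe, Finset.mem_filter] at hv
        show Nat.card {i : Fin d | ∑ j, L i j * (mpt s v).rep j = 0} = k
        rw [mpt_count L s hs]
        exact hv.2
    rw [himg]
    apply Set.ncard_image_of_injOn
    apply (mpt_injOn s).mono
    intro v hv
    rw [Finset.mem_coe, Finset.mem_filter, hHm] at hv
    exact ⟨hv.1.1, hv.1.2.1⟩
  have hsum : ∑ v ∈ H, (3 - (mmu f v.1 v.2 : ℤ))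
      = ∑ k ∈ Finset.Icc 2 d, (t k : ℤ) * (3 - (k : ℤ)) := by
    rw [← Finset.sum_fiberwise_of_maps_to (s := H) (t := Finset.Icc 2 d)
      (g := fun v => mmu f v.1 v.2)]
    · apply Finset.sum_congr rfl
      intro k hk
      rw [Finset.mem_Icc] at hk
      rw [htk k hk.1, ← nsmul_eq_mul, ← Finset.sum_const]
      apply Finset.sum_congr rfl
      intro v hv
      rw [Finset.mem_filter] at hv
      rw [hv.2]
    · intro v hv
      rw [hHm] at hv
      rw [Finset.mem_Icc]
      have := mle_le f v.1 v.2
      have := mle_eq f v.1 v.2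
      exact ⟨hv.2.2, by omega⟩
  have hsplit : Finset.Icc 2 d = insert 2 (Finset.Icc 3 d) := by
    ext k
    simp
    omega
  rw [hsum, hsplit, Finset.sum_insert (by simp)] at hhalf
  have hcast : ((∑ k ∈ Finset.Icc 3 d, t k * (k - 3) : ℕ) : ℤ)
      = - ∑ k ∈ Finset.Icc 3 d, (t k : ℤ) * (3 - (k : ℤ)) := by
    rw [Nat.cast_sum, ← Finset.sum_neg_distrib]
    apply Finset.sum_congr rfl
    intro k hk
    rw [Finset.mem_Icc] at hk
    rw [Nat.cast_mul, Nat.cast_sub hk.1]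
    push_cast
    ring
  have : (3 : ℤ) + ((∑ k ∈ Finset.Icc 3 d, t k * (k - 3) : ℕ) : ℤ) ≤ (t 2 : ℤ) := by
    rw [hcast]
    push_cast at hhalf
    linarith
  exact_mod_cast this
end

section
/- Let C be a reduced plane curve of degree d over an algebraically closed field, and let T be the set of singular points of C. Then H(C) < −1 if and only if T is nonempty and H(C,T) < −1; and in that case H(C) = H(C,U) for some nonempty subset U ⊆ T (so the infimum defining H(C) is attained on a subset of the singular points). -/
open MvPolynomial

noncomputable section

/-- The ideal of polynomials vanishing on the affine cone over the projective point
with homogeneous coordinate vector `p`. -/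
def coneIdeal (K : Type*) [Field K] {n : ℕ} (p : Fin n → K) :
    Ideal (MvPolynomial (Fin n) K) where
  carrier := {f | ∀ t : K, eval (t • p) f = 0}
  add_mem' := by
    intro a b ha hb t
    simp only [Set.mem_setOf_eq] at ha hb ⊢
    simp [map_add, ha t, hb t]
  zero_mem' := by
    intro t
    simp
  smul_mem' := by
    intro c f hf t
    simp only [Set.mem_setOf_eq] at hf ⊢
    simp [smul_eq_mul, map_mul, hf t]

/-- The multiplicity of the plane curve defined by `F` at a projective point `P`:
the largest `k` with `F ∈ I(P)^k`. -/
def multAt (K : Type*) [Field K] (F : MvPolynomial (Fin 3) K)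
    (P : Projectivization K (Fin 3 → K)) : ℕ :=
  sSup {k : ℕ | F ∈ (coneIdeal K P.rep) ^ k}

/-- The `H`-constant `H(C,S) = (d² − Σ_{p∈S} mult_p(C)²)/|S|` of the degree-`d` curve
defined by `F` with respect to a finite set `S` of projective points. -/
def Hconst (K : Type*) [Field K] (F : MvPolynomial (Fin 3) K) (d : ℕ)
    (S : Finset (Projectivization K (Fin 3 → K))) : ℝ :=
  ((d : ℝ) ^ 2 - ∑ P ∈ S, (multAt K F P : ℝ) ^ 2) / (S.card : ℝ)

/-- `H(C) = inf { H(C,S) : S nonempty finite }`. -/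
def HconstInf (K : Type*) [Field K] (F : MvPolynomial (Fin 3) K) (d : ℕ) : ℝ :=
  sInf {x : ℝ | ∃ S : Finset (Projectivization K (Fin 3 → K)),
    S.Nonempty ∧ x = Hconst K F d S}

theorem Hconst_key (K : Type*) [Field K] (d : ℕ) (F : MvPolynomial (Fin 3) K)
    (T : Finset (Projectivization K (Fin 3 → K)))
    (hT : ∀ P, P ∈ T ↔ 2 ≤ multAt K F P)
    (S : Finset (Projectivization K (Fin 3 → K))) (hS : S.Nonempty)
    (h : Hconst K F d S < -1) :
    ∃ U : Finset (Projectivization K (Fin 3 → K)),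
      U ⊆ T ∧ U.Nonempty ∧ Hconst K F d U ≤ Hconst K F d S := by
  classical
  have hsplit1 := Finset.sum_filter_add_sum_filter_not S (fun P => P ∈ T)
    (fun P => (multAt K F P : ℝ) ^ 2)
  have hsplit2 := Finset.card_filter_add_card_filter_not (s := S) (fun P => P ∈ T)
  have hle : ∑ P ∈ S with ¬ P ∈ T, (multAt K F P : ℝ) ^ 2 ≤
      ((S.filter (fun P => ¬ P ∈ T)).card : ℝ) := by
    have := Finset.sum_le_card_nsmul (S.filter (fun P => ¬ P ∈ T))
      (fun P => (multAt K F P : ℝ) ^ 2) 1 (by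
        intro P hP
        have h2 : ¬ 2 ≤ multAt K F P := fun hh => (Finset.mem_filter.1 hP).2 ((hT P).2 hh)
        have h3 : multAt K F P ≤ 1 := by omega
        have h4 : (multAt K F P : ℝ) ≤ 1 := by exact_mod_cast h3
        exact pow_le_one₀ (Nat.cast_nonneg _) h4)
    simpa using this
  have hSpos : (0 : ℝ) < S.card := by exact_mod_cast hS.card_pos
  have hc : ((S.filter (fun P => P ∈ T)).card : ℝ) +
      ((S.filter (fun P => ¬ P ∈ T)).card : ℝ) = S.card := by exact_mod_cast hsplit2
  have hN : (d : ℝ) ^ 2 - ∑ P ∈ S, (multAt K F P : ℝ) ^ 2 = Hconst K F d S * S.card := by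
    unfold Hconst
    field_simp
  have hb : (0 : ℝ) ≤ ((S.filter (fun P => ¬ P ∈ T)).card : ℝ) := Nat.cast_nonneg _
  have hUN : (S.filter (fun P => P ∈ T)).Nonempty := by
    rw [Finset.nonempty_iff_ne_empty]
    intro he
    rw [he] at hsplit1 hc
    simp only [Finset.sum_empty, Finset.card_empty, Nat.cast_zero] at hsplit1 hc
    nlinarith [sq_nonneg (d : ℝ)]
  refine ⟨S.filter (fun P => P ∈ T), fun P hP => (Finset.mem_filter.1 hP).2, hUN, ?_⟩
  have hUpos : (0 : ℝ) < (S.filter (fun P => P ∈ T)).card := by exact_mod_cast hUN.card_pos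
  rw [Hconst, div_le_iff₀ hUpos]
  nlinarith

theorem Hconst_mono (K : Type*) [Field K] (d : ℕ) (F : MvPolynomial (Fin 3) K)
    (T : Finset (Projectivization K (Fin 3 → K)))
    (hT : ∀ P, P ∈ T ↔ 2 ≤ multAt K F P)
    (U : Finset (Projectivization K (Fin 3 → K))) (hU : U.Nonempty) (hUT : U ⊆ T)
    (h : Hconst K F d U < -1) : Hconst K F d T < -1 := by
  have hUpos : (0 : ℝ) < U.card := by exact_mod_cast hU.card_pos
  have hTpos : (0 : ℝ) < T.card := by exact_mod_cast (hU.mono hUT).card_pos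
  rw [Hconst, div_lt_iff₀ hUpos] at h
  rw [Hconst, div_lt_iff₀ hTpos]
  have := Finset.sum_le_sum_of_subset_of_nonneg (f := fun P => (multAt K F P : ℝ) ^ 2 - 1) hUT (by
    intro P hP _
    have h2 : (2 : ℝ) ≤ multAt K F P := by exact_mod_cast (hT P).1 hP
    nlinarith)
  simp only [Finset.sum_sub_distrib, Finset.sum_const, nsmul_eq_mul, mul_one] at this
  linarith

/-- For a reduced plane curve `C` of degree `d` with (finite) set `T` of singular
points: `H(C) < −1` iff `T` is nonempty and `H(C,T) < −1`, and in that case the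
infimum `H(C)` is attained as `H(C,U)` for some nonempty `U ⊆ T`. -/
theorem Hconstant_singular_points (K : Type*) [Field K] [IsAlgClosed K]
    (d : ℕ) (F : MvPolynomial (Fin 3) K) (hF0 : F ≠ 0)
    (hFd : F.IsHomogeneous d) (hsf : Squarefree F)
    (T : Finset (Projectivization K (Fin 3 → K)))
    (hT : ∀ P, P ∈ T ↔ 2 ≤ multAt K F P) :
    (HconstInf K F d < -1 ↔ (T.Nonempty ∧ Hconst K F d T < -1)) ∧
    (HconstInf K F d < -1 →
      ∃ U : Finset (Projectivization K (Fin 3 → K)),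
        U ⊆ T ∧ U.Nonempty ∧ HconstInf K F d = Hconst K F d U) := by
  classical
  set A : Set ℝ := {x : ℝ | ∃ S : Finset (Projectivization K (Fin 3 → K)),
    S.Nonempty ∧ x = Hconst K F d S} with hA
  have hInf : HconstInf K F d = sInf A := rfl
  -- finitely many candidate values
  set V : Finset (Finset (Projectivization K (Fin 3 → K))) :=
    T.powerset.filter (fun U => U.Nonempty) with hV
  have hmemV : ∀ U, U ∈ V ↔ U ⊆ T ∧ U.Nonempty := by
    intro U; simp [hV]
  have hAne : A.Nonempty := by
    obtain ⟨P⟩ : Nonempty (Projectivization K (Fin 3 → K)) := inferInstance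
    exact ⟨_, {P}, Finset.singleton_nonempty P, rfl⟩
  have hex : ∀ S : Finset (Projectivization K (Fin 3 → K)), S.Nonempty →
      Hconst K F d S < -1 → T.Nonempty ∧ Hconst K F d T < -1 := by
    intro S hS h
    obtain ⟨U, hUT, hU, hle⟩ := Hconst_key K d F T hT S hS h
    exact ⟨hU.mono hUT, Hconst_mono K d F T hT U hU hUT (lt_of_le_of_lt hle h)⟩
  have hfwd : HconstInf K F d < -1 → T.Nonempty ∧ Hconst K F d T < -1 := by
    intro h
    rw [hInf] at h
    obtain ⟨x, ⟨S, hS, rfl⟩, hx⟩ := exists_lt_of_csInf_lt hAne h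
    exact hex S hS hx
  have hmin : T.Nonempty ∧ Hconst K F d T < -1 →
      HconstInf K F d < -1 ∧ ∃ U : Finset (Projectivization K (Fin 3 → K)),
        U ⊆ T ∧ U.Nonempty ∧ HconstInf K F d = Hconst K F d U := by
    rintro ⟨hTn, hTl⟩
    have hTV : T ∈ V := (hmemV T).2 ⟨Finset.Subset.refl T, hTn⟩
    obtain ⟨U, hUV, hUmin⟩ := Finset.exists_min_image V (Hconst K F d) ⟨T, hTV⟩
    obtain ⟨hUT, hU⟩ := (hmemV U).1 hUV
    have hUl : Hconst K F d U < -1 := lt_of_le_of_lt (hUmin T hTV) hTl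
    have hleast : IsLeast A (Hconst K F d U) := by
      refine ⟨⟨U, hU, rfl⟩, ?_⟩
      rintro x ⟨S, hS, rfl⟩
      by_cases hSl : Hconst K F d S < -1
      · obtain ⟨W, hWT, hW, hle⟩ := Hconst_key K d F T hT S hS hSl
        exact (hUmin W ((hmemV W).2 ⟨hWT, hW⟩)).trans hle
      · linarith
    have heq : HconstInf K F d = Hconst K F d U := hleast.csInf_eq
    exact ⟨heq ▸ hUl, U, hUT, hU, heq⟩
  exact ⟨⟨hfwd, fun h => (hmin h).1⟩, fun h => (hmin (hfwd h)).2⟩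

end
end

section
/- Let C be a reduced singular plane curve over an algebraically closed field and let T be the set of singular points of C. If H(C,U) < H(C,T) for some nonempty proper subset U ⊊ T, then H(C,T) < −4. -/
open MvPolynomial

noncomputable section

/-- For a reduced singular plane curve `C` with set `T` of singular points: if
`H(C,U) < H(C,T)` for some nonempty proper subset `U ⊊ T`, then `H(C,T) < −4`. -/
theorem Hconstant_proper_subset (K : Type*) [Field K] [IsAlgClosed K]
    (d : ℕ) (F : MvPolynomial (Fin 3) K) (hF0 : F ≠ 0)
    (hFd : F.IsHomogeneous d) (hsf : Squarefree F)
    (T : Finset (Projectivization K (Fin 3 → K)))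
    (hT : ∀ P, P ∈ T ↔ 2 ≤ multAt K F P) (hTne : T.Nonempty)
    (U : Finset (Projectivization K (Fin 3 → K)))
    (hU : U ⊂ T) (hUne : U.Nonempty)
    (hlt : Hconst K F d U < Hconst K F d T) :
    Hconst K F d T < -4 := by
  classical
  unfold Hconst at *
  obtain ⟨hsub, hns⟩ := Finset.ssubset_iff_subset_ne.mp hU
  have hcard : (U.card : ℝ) < T.card := by exact_mod_cast Finset.card_lt_card hU
  have hu : (0 : ℝ) < U.card := by exact_mod_cast hUne.card_pos
  have ht : (0 : ℝ) < T.card := hu.trans hcard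
  have hsplit := Finset.sum_sdiff (f := fun P => (multAt K F P : ℝ) ^ 2) hsub
  have hge : ((T.card : ℝ) - U.card) * 4 ≤ ∑ P ∈ T \ U, (multAt K F P : ℝ) ^ 2 := by
    have h := Finset.card_nsmul_le_sum (T \ U) (fun P => (multAt K F P : ℝ) ^ 2) 4 (by
      intro P hP
      have h2 : (2 : ℝ) ≤ multAt K F P := by
        exact_mod_cast (hT P).mp (Finset.mem_sdiff.mp hP).1
      nlinarith)
    have hc := Finset.card_sdiff_add_card_eq_card hsub
    have hc' : ((T \ U).card : ℝ) + U.card = T.card := by exact_mod_cast hc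
    rw [nsmul_eq_mul] at h
    rw [← hc']
    simpa using h
  set h := ((d : ℝ) ^ 2 - ∑ P ∈ T, (multAt K F P : ℝ) ^ 2) / (T.card : ℝ) with hh
  have hT' : h * T.card = (d : ℝ) ^ 2 - ∑ P ∈ T, (multAt K F P : ℝ) ^ 2 := by
    rw [hh]; field_simp
  rw [div_lt_iff₀ hu] at hlt
  by_contra! hc
  nlinarith [mul_nonneg (sub_nonneg.mpr hc) (sub_nonneg.mpr hcard.le)]

end
end

section
/- Let V be a finite-dimensional real inner product space and let v_1,…,v_r be a basis of V such that ⟨v_i, v_j⟩ ≤ 0 for all i ≠ j. If v ∈ V satisfies ⟨v, v_i⟩ ≥ 0 for all i, then v = a_1v_1 + ⋯ + a_rv_r with a_i ≥ 0 for all i. -/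
/-- Let `V` be a finite-dimensional real inner product space with a basis `v_1, …, v_r`
such that `⟨v_i, v_j⟩ ≤ 0` for all `i ≠ j`.  If `⟨v, v_i⟩ ≥ 0` for all `i`, then
`v = a_1 v_1 + ⋯ + a_r v_r` with all `a_i ≥ 0`. -/
theorem nonneg_coords_of_obtuse_basis (V : Type*) [NormedAddCommGroup V]
    [InnerProductSpace ℝ V] [FiniteDimensional ℝ V]
    (r : ℕ) (b : Module.Basis (Fin r) ℝ V)
    (hneg : ∀ i j, i ≠ j → (inner ℝ (b i) (b j) : ℝ) ≤ 0)
    (v : V) (hv : ∀ i, (0 : ℝ) ≤ inner ℝ v (b i)) :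
    ∃ a : Fin r → ℝ, (∀ i, 0 ≤ a i) ∧ v = ∑ i, a i • b i := by
  refine ⟨fun i => b.repr v i, ?_, (b.sum_repr v).symm⟩
  set a : Fin r → ℝ := fun i => b.repr v i with ha
  set P : V := ∑ i, max (a i) 0 • b i with hP
  set N : V := ∑ i, max (-a i) 0 • b i with hN
  have hPN : v = P - N := by
    rw [hP, hN, ← Finset.sum_sub_distrib]
    conv_lhs => rw [← b.sum_repr v]
    refine Finset.sum_congr rfl fun i _ => ?_
    rw [← sub_smul]
    congr 1
    change a i = _
    rcases le_total (a i) 0 with h | h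
    · rw [max_eq_right h, max_eq_left (by linarith)]; ring
    · rw [max_eq_left h, max_eq_right (by linarith)]; ring
  have h1 : 0 ≤ inner ℝ v N := by
    rw [hN, inner_sum]
    refine Finset.sum_nonneg fun i _ => ?_
    rw [real_inner_smul_right]
    exact mul_nonneg (le_max_right _ _) (hv i)
  have h2 : inner ℝ P N ≤ 0 := by
    rw [hP, hN, sum_inner]
    refine Finset.sum_nonpos fun i _ => ?_
    rw [inner_sum]
    refine Finset.sum_nonpos fun j _ => ?_
    rw [real_inner_smul_left, real_inner_smul_right]
    by_cases hij : i = j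
    · subst hij
      rcases le_total (a i) 0 with h | h
      · rw [max_eq_right h]; simp
      · rw [max_eq_right (show -a i ≤ 0 by linarith)]; simp
    · exact mul_nonpos_of_nonneg_of_nonpos (le_max_right _ _)
        (mul_nonpos_of_nonneg_of_nonpos (le_max_right _ _) (hneg i j hij))
  have h3 : inner ℝ v N = inner ℝ P N - inner ℝ N N := by
    conv_lhs => rw [hPN]
    exact inner_sub_left _ _ _
  have h4 : N = 0 := by
    have h5 : inner ℝ N N ≤ 0 := by linarith
    exact inner_self_eq_zero.mp (le_antisymm h5 real_inner_self_nonneg)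
  intro i
  have h6 := Fintype.linearIndependent_iff.mp b.linearIndependent
    (fun i => max (-a i) 0) (hN.symm.trans h4) i
  have h7 : -a i ≤ 0 := h6 ▸ le_max_left (-a i) 0
  change 0 ≤ a i
  linarith
end
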